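/- (Strichartz estimates for density functions.) Suppose α₀, α₁, α₂ ≥ 0. When d = 1, assume α₀ = min{α₁, α₂}. When d ≥ 2, assume α₁ + α₂ > (d−1)/2 and that α₀ satisfies: α₀ = α₁ + α₂ − (d−1)/2 if max{α₁,α₂} < (d−1)/2; α₀ < min{α₁,α₂} if max{α₁,α₂} = (d−1)/2; α₀ = min{α₁,α₂} if max{α₁,α₂} > (d−1)/2. Then there is a constant C = C(d, α₀, α₁, α₂) such that for every Hilbert–Schmidt operator γ₀ on L²(ℝ^d) with ‖⟨∇⟩^{α₁} γ₀ ⟨∇⟩^{α₂}‖_{𝔖²} < ∞, the density of the free evolution satisfies ‖ |∇|^{1/2} ρ_{e^{itΔ} γ₀ e^{−itΔ}} ‖_{L²_t(ℝ; H^{α₀}_x)} ≤ C ‖⟨∇⟩^{α₁} γ₀ ⟨∇⟩^{α₂}‖_{𝔖²}. -/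

import Mathlib

open MeasureTheory Complex Filter
open scoped ENNReal NNReal RealInnerProductSpace Topology ComplexConjugate

noncomputable section

/-- `d`-dimensional Euclidean space `ℝ^d`. -/
abbrev Vd (d : ℕ) := EuclideanSpace ℝ (Fin d)

/-- The Japanese bracket `⟨ξ⟩ = (1 + |ξ|²)^{1/2}`. -/
noncomputable def jb {d : ℕ} (ξ : Vd d) : ℝ := (1 + ‖ξ‖ ^ 2) ^ ((1 : ℝ) / 2)

/-- Fourier transform, with the paper's convention `ĥ(ξ) = ∫ e^{-i x·ξ} h(x) dx`. -/
noncomputable def ft {d : ℕ} (h : Vd d → ℂ) (ξ : Vd d) : ℂ :=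
  ∫ x : Vd d, Complex.exp (-(Complex.I * Complex.ofReal (⟪x, ξ⟫))) * h x

/-- Inverse Fourier transform `ǧ(x) = (2π)^{-d} ∫ e^{i x·ξ} g(ξ) dξ`. -/
noncomputable def invFt {d : ℕ} (h : Vd d → ℂ) (x : Vd d) : ℂ :=
  (((2 * Real.pi) ^ d)⁻¹ : ℝ) • ∫ ξ : Vd d, Complex.exp (Complex.I * Complex.ofReal (⟪x, ξ⟫)) * h ξ

/-- The space Fourier transform (at frequency `ξ`, time `t`) of the density of
`e^{itΔ} γ₀ e^{-itΔ}`, expressed via `G = γ̂₀`, the `2d`-dimensional Fourier transform of the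
integral kernel of `γ₀`:  `ρ̂(t,ξ) = (2π)^{-d} ∫ e^{-it(|η|²-|ξ-η|²)} G(η, ξ-η) dη`. -/
noncomputable def densFT {d : ℕ} (G : Vd d × Vd d → ℂ) (t : ℝ) (ξ : Vd d) : ℂ :=
  (((2 * Real.pi) ^ d)⁻¹ : ℝ) •
    ∫ η : Vd d, Complex.exp (-(Complex.I * Complex.ofReal (t * (‖η‖ ^ 2 - ‖ξ - η‖ ^ 2)))) * G (η, ξ - η)

/-- `‖ |∇|^s ρ_{e^{itΔ}γ₀e^{-itΔ}} ‖_{L²_t(ℝ; H^{α₀}_x)}`, computed on the space Fourier side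
(by Plancherel) from `G = γ̂₀`. -/
noncomputable def densStriNorm {d : ℕ} (s α₀ : ℝ) (G : Vd d × Vd d → ℂ) : ℝ≥0∞ :=
  (∫⁻ t : ℝ, ∫⁻ ξ : Vd d,
      ENNReal.ofReal (‖ξ‖ ^ (2 * s) * jb ξ ^ (2 * α₀)) * (‖densFT G t ξ‖₊ : ℝ≥0∞) ^ (2:ℝ)) ^ ((1:ℝ)/2)

/-- The weighted Hilbert–Schmidt norm `‖⟨∇⟩^{α₁} γ₀ ⟨∇⟩^{α₂}‖_{𝔖²}`, computed (by Plancherel)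
from `G = γ̂₀`. -/
noncomputable def wHSnorm {d : ℕ} (α₁ α₂ : ℝ) (G : Vd d × Vd d → ℂ) : ℝ≥0∞ :=
  (∫⁻ p : Vd d × Vd d,
      ENNReal.ofReal (jb p.1 ^ (2 * α₁) * jb p.2 ^ (2 * α₂)) * (‖G p‖₊ : ℝ≥0∞) ^ (2:ℝ)) ^ ((1:ℝ)/2)

open FourierTransform SchwartzMap in
/-- The Plancherel bound for integrable functions, both sides possibly infinite. -/
theorem lintegral_enorm_fourier_sq_le {h : ℝ → ℂ} (h1 : Integrable h) :
    ∫⁻ t, ‖𝓕 h t‖ₑ ^ (2 : ℝ) ≤ ∫⁻ s, ‖h s‖ₑ ^ (2 : ℝ) := by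
  by_cases htop : ∫⁻ s, ‖h s‖ₑ ^ (2 : ℝ) = ⊤
  · rw [htop]; exact le_top
  have h2 : MemLp h 2 := by
    refine ⟨h1.aestronglyMeasurable, ?_⟩
    rw [eLpNorm_lt_top_iff_lintegral_rpow_enorm_lt_top (by norm_num) (by norm_num)]
    simpa using lt_top_iff_ne_top.mpr htop
  set F : Lp ℂ 2 (volume : Measure ℝ) := 𝓕 (h2.toLp h) with hF
  have hcont : Continuous (𝓕 h) :=
    VectorFourier.fourierIntegral_continuous Real.continuous_fourierChar
      (innerSL ℝ).continuous₂ h1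
  have hae : ∀ᵐ x, F x = 𝓕 h x := by
    refine ae_eq_of_integral_contDiff_smul_eq
      ((Lp.memLp F).locallyIntegrable (by norm_num)) hcont.locallyIntegrable ?_
    intro g g_smooth g_cpt
    have hg₁ : HasCompactSupport (Complex.ofRealCLM ∘ g) := g_cpt.comp_left rfl
    have hg₂ : ContDiff ℝ ((⊤ : ℕ∞) : WithTop ℕ∞) (Complex.ofRealCLM ∘ g) := by fun_prop
    set φ : 𝓢(ℝ, ℂ) := hg₁.toSchwartzMap hg₂ with hφ
    have hφx : ∀ x, φ x = (g x : ℂ) := fun x => rfl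
    have e1 : ∫ x, g x • F x = ∫ x, φ x • F x := by simp [hφx]
    have e2 : ∫ x, φ x • F x = ∫ x, (𝓕 φ) x • h x := by
      have := congrArg (fun T => T φ) (Lp.fourier_toTemperedDistribution_eq (h2.toLp h))
      simp only [TemperedDistribution.fourier_apply, Lp.toTemperedDistribution_apply] at this
      rw [hF, ← this]
      refine integral_congr_ae ?_
      filter_upwards [h2.coeFn_toLp] with x hx
      rw [hx]
    have e3 : ∫ x, (𝓕 φ) x • h x = ∫ x, φ x • 𝓕 h x := by
      have := VectorFourier.integral_fourierIntegral_smul_eq_flip (μ := volume) (ν := volume)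
        (L := innerₗ ℝ) Real.continuous_fourierChar
        (by exact continuous_inner) φ.integrable h1
      rw [SchwartzMap.fourier_coe]
      refine this.trans ?_
      simp only [flip_innerₗ]
      rfl
    rw [e1, e2, e3]
    simp [hφx]
  have key : ∀ u : Lp ℂ 2 (volume : Measure ℝ), ∫⁻ x, ‖u x‖ₑ ^ (2 : ℝ) = ‖u‖ₑ ^ (2 : ℝ) := by
    intro u
    rw [Lp.enorm_def, eLpNorm_eq_lintegral_rpow_enorm_toReal (by norm_num) (by norm_num)]
    rw [← ENNReal.rpow_mul]
    simp
  have hl : ∫⁻ t, ‖𝓕 h t‖ₑ ^ (2 : ℝ) = ∫⁻ t, ‖F t‖ₑ ^ (2 : ℝ) :=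
    lintegral_congr_ae (by filter_upwards [hae] with x hx; rw [hx])
  have hr : ∫⁻ t, ‖h t‖ₑ ^ (2 : ℝ) = ∫⁻ t, ‖h2.toLp h t‖ₑ ^ (2 : ℝ) :=
    lintegral_congr_ae (by filter_upwards [h2.coeFn_toLp] with x hx; rw [hx])
  rw [hl, hr, key, key, hF]
  have : ‖(𝓕 (h2.toLp h) : Lp ℂ 2 (volume : Measure ℝ))‖ = ‖h2.toLp h‖ := Lp.norm_fourier_eq _
  rw [← ofReal_norm, ← ofReal_norm, this]

/-- Measure-preserving orthogonal coordinates whose first axis points along `ξ`. -/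
theorem exists_orthogonal_coordinates {n : ℕ} {ξ : Vd (n + 1)} (hξ : ξ ≠ 0) :
    ∃ e : ℝ × Vd n ≃ᵐ Vd (n + 1), MeasurePreserving e ∧
      ∀ s y, ⟪e (s, y), ξ⟫ = s * ‖ξ‖ ∧ ‖e (s, y)‖ ^ 2 = s ^ 2 + ‖y‖ ^ 2 := by
  have hn : ‖ξ‖ ≠ 0 := norm_ne_zero_iff.mpr hξ
  obtain ⟨b, hb⟩ := Orthonormal.exists_orthonormalBasis_extension_of_card_eq (𝕜 := ℝ)
    (E := Vd (n + 1)) (ι := Fin (n + 1)) (by simp) (v := fun _ => (‖ξ‖⁻¹ : ℝ) • ξ) (s := {0})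
    (by
      rw [orthonormal_subsingleton_iff]
      intro i
      simp [norm_smul, hn])
  have hb0 : ξ = ‖ξ‖ • b 0 := by
    rw [hb 0 rfl, smul_smul, mul_inv_cancel₀ hn, one_smul]
  let e1 : ℝ × Vd n ≃ᵐ ℝ × (Fin n → ℝ) :=
    (MeasurableEquiv.refl ℝ).prodCongr (MeasurableEquiv.toLp 2 (Fin n → ℝ)).symm
  let e2 : ℝ × (Fin n → ℝ) ≃ᵐ (Fin (n + 1) → ℝ) :=
    (MeasurableEquiv.piFinSuccAbove (fun _ => ℝ) 0).symm
  let e3 : (Fin (n + 1) → ℝ) ≃ᵐ Vd (n + 1) := MeasurableEquiv.toLp 2 _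
  let e4 : Vd (n + 1) ≃ᵐ Vd (n + 1) := b.repr.symm.toHomeomorph.toMeasurableEquiv
  have m1 : MeasurePreserving e1 :=
    (MeasurePreserving.id volume).prod (EuclideanSpace.volume_preserving_symm_measurableEquiv_toLp _)
  have m2 : MeasurePreserving e2 := (volume_preserving_piFinSuccAbove (fun _ => ℝ) 0).symm _
  have m3 : MeasurePreserving e3 := (EuclideanSpace.volume_preserving_symm_measurableEquiv_toLp _).symm
  have m4 : MeasurePreserving e4 := b.measurePreserving_repr_symm
  refine ⟨((e1.trans e2).trans e3).trans e4, m4.comp (m3.comp (m2.comp m1)), fun s y => ?_⟩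
  set z : Vd (n + 1) := e3 (e2 (e1 (s, y))) with hz
  have hz0 : z 0 = s := rfl
  have hzs : ∀ i : Fin n, z i.succ = y i := fun i => rfl
  have he : (((e1.trans e2).trans e3).trans e4) (s, y) = b.repr.symm z := rfl
  rw [he]
  constructor
  · conv_lhs => rw [hb0]
    rw [inner_smul_right, ← b.repr.inner_map_map]
    simp [EuclideanSpace.inner_single_right, hz0, mul_comm]
  · rw [LinearIsometryEquiv.norm_map, EuclideanSpace.norm_sq_eq, EuclideanSpace.norm_sq_eq,
      Fin.sum_univ_succ]
    simp [hz0, hzs]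

theorem weight_le_of_le {A B r α₀ α₁ α₂ : ℝ} (hA : 1 ≤ A) (hAB : A ≤ B) (hr : 0 ≤ r)
    (h₀ : 0 ≤ α₀) (h₁ : 0 ≤ α₁) (h₀₂ : α₀ ≤ α₂) :
    (A + r) ^ (-α₁) * (B + r) ^ (-α₂) ≤ B ^ (-α₀) * (1 + r) ^ (-(α₁ + α₂ - α₀)) := by
  have hB : 1 ≤ B := hA.trans hAB
  have e1 : (A + r) ^ (-α₁) ≤ (1 + r) ^ (-α₁) :=
    Real.rpow_le_rpow_of_nonpos (by positivity) (by linarith) (by linarith)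
  have e2 : (B + r) ^ (-α₀) ≤ B ^ (-α₀) :=
    Real.rpow_le_rpow_of_nonpos (by positivity) (by linarith) (by linarith)
  have e3 : (B + r) ^ (-(α₂ - α₀)) ≤ (1 + r) ^ (-(α₂ - α₀)) :=
    Real.rpow_le_rpow_of_nonpos (by positivity) (by linarith) (by linarith)
  calc (A + r) ^ (-α₁) * (B + r) ^ (-α₂)
      = (A + r) ^ (-α₁) * ((B + r) ^ (-α₀) * (B + r) ^ (-(α₂ - α₀))) := by
        rw [← Real.rpow_add (by positivity)]; ring_nf
    _ ≤ (1 + r) ^ (-α₁) * (B ^ (-α₀) * (1 + r) ^ (-(α₂ - α₀))) := by gcongr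
    _ = B ^ (-α₀) * (1 + r) ^ (-(α₁ + α₂ - α₀)) := by
        rw [mul_left_comm, ← Real.rpow_add (by positivity)]; ring_nf

theorem integrable_norm_rpow_mul_one_add_norm_sq_rpow {n : ℕ} (hn : 1 ≤ n) {α₁ α₂ : ℝ}
    (h₁ : α₁ < (n : ℝ) / 2) (hs : (n : ℝ) / 2 < α₁ + α₂) :
    Integrable (fun z : Vd n => ‖z‖ ^ (-(2 * α₁)) * (1 + ‖z‖ ^ 2) ^ (-α₂)) := by
  have : Nonempty (Fin n) := ⟨⟨0, hn⟩⟩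
  have hmeas : Measurable fun y : ℝ => y ^ (n - 1) • (y ^ (-(2 * α₁)) * (1 + y ^ 2) ^ (-α₂)) := by
    fun_prop
  have hpow : ∀ y : ℝ, 0 < y → y ^ (n - 1) * y ^ (-(2 * α₁)) = y ^ ((n : ℝ) - 1 - 2 * α₁) := by
    intro y hy
    rw [← Real.rpow_natCast, ← Real.rpow_add hy, Nat.cast_sub hn]
    norm_num [sub_eq_add_neg]
  refine (integrable_fun_norm_addHaar (E := Vd n) volume
    (f := fun r => r ^ (-(2 * α₁)) * (1 + r ^ 2) ^ (-α₂))).mpr ?_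
  rw [finrank_euclideanSpace_fin, ← Set.Ioc_union_Ioi_eq_Ioi zero_le_one, integrableOn_union]
  constructor
  · have hi : IntegrableOn (fun y : ℝ => y ^ ((n : ℝ) - 1 - 2 * α₁)) (Set.Ioc 0 1) :=
      (intervalIntegrable_iff_integrableOn_Ioc_of_le zero_le_one).mp
        (intervalIntegral.intervalIntegrable_rpow' (by linarith))
    refine hi.mono' hmeas.aestronglyMeasurable ?_
    filter_upwards [ae_restrict_mem measurableSet_Ioc] with y hy
    have hy0 : 0 < y := hy.1
    rw [smul_eq_mul, ← mul_assoc, hpow y hy0, Real.norm_of_nonneg (by positivity)]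
    refine mul_le_of_le_one_right (by positivity) ?_
    exact Real.rpow_le_one_of_one_le_of_nonpos (by nlinarith) (by linarith)
  · have hi : IntegrableOn (fun y : ℝ => y ^ ((n : ℝ) - 1 - 2 * α₁ - 2 * α₂)) (Set.Ioi 1) :=
      integrableOn_Ioi_rpow_of_lt (by linarith) zero_lt_one
    refine hi.mono' hmeas.aestronglyMeasurable ?_
    filter_upwards [ae_restrict_mem measurableSet_Ioi] with y hy
    have hy0 : 0 < y := zero_lt_one.trans hy
    rw [smul_eq_mul, ← mul_assoc, hpow y hy0, Real.norm_of_nonneg (by positivity),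
      sub_eq_add_neg _ (2 * α₂), Real.rpow_add hy0]
    gcongr
    calc (1 + y ^ 2) ^ (-α₂) ≤ (y ^ 2) ^ (-α₂) :=
          Real.rpow_le_rpow_of_nonpos (by positivity) (by linarith) (by linarith)
      _ = y ^ (-(2 * α₂)) := by
          rw [← Real.rpow_natCast, ← Real.rpow_mul hy0.le]; push_cast; ring_nf

theorem weight_le_scaled {n : ℕ} {A B α₁ α₂ : ℝ} (hA : 1 ≤ A) (hAB : A ≤ B)
    (h₁ : 0 ≤ α₁) {y : Vd n} (hy : y ≠ 0) :
    (A + ‖y‖ ^ 2) ^ (-α₁) * (B + ‖y‖ ^ 2) ^ (-α₂) ≤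
      B ^ (-(α₁ + α₂)) * (‖B ^ (-(1 / 2) : ℝ) • y‖ ^ (-(2 * α₁)) *
        (1 + ‖B ^ (-(1 / 2) : ℝ) • y‖ ^ 2) ^ (-α₂)) := by
  have hB : 0 < B := by linarith
  have hy0 : 0 < ‖y‖ := norm_pos_iff.mpr hy
  have hnorm : ‖B ^ (-(1 / 2) : ℝ) • y‖ ^ 2 = B⁻¹ * ‖y‖ ^ 2 := by
    rw [norm_smul, mul_pow, Real.norm_of_nonneg (by positivity), ← Real.rpow_natCast,
      ← Real.rpow_mul hB.le, ← Real.rpow_neg_one]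
    norm_num
  have e1 : ‖B ^ (-(1 / 2) : ℝ) • y‖ ^ (-(2 * α₁)) = (B⁻¹ * ‖y‖ ^ 2) ^ (-α₁) := by
    rw [← hnorm, ← Real.rpow_natCast, ← Real.rpow_mul (norm_nonneg _)]
    push_cast; ring_nf
  rw [e1, hnorm]
  have e2 : (A + ‖y‖ ^ 2) ^ (-α₁) ≤ (‖y‖ ^ 2) ^ (-α₁) :=
    Real.rpow_le_rpow_of_nonpos (by positivity) (by linarith) (by linarith)
  have e3 : B ^ (-(α₁ + α₂)) * ((B⁻¹ * ‖y‖ ^ 2) ^ (-α₁) * (1 + B⁻¹ * ‖y‖ ^ 2) ^ (-α₂)) =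
      (‖y‖ ^ 2) ^ (-α₁) * (B + ‖y‖ ^ 2) ^ (-α₂) := by
    have : B + ‖y‖ ^ 2 = B * (1 + B⁻¹ * ‖y‖ ^ 2) := by field_simp
    rw [this, Real.mul_rpow hB.le (by positivity), Real.mul_rpow (by positivity) (by positivity),
      Real.inv_rpow hB.le, neg_add, Real.rpow_add hB]
    have : B ^ (-α₁) ≠ 0 := by positivity
    field_simp
  rw [e3]
  gcongr

theorem lintegral_weight_le_of_le {n : ℕ} {α₀ α₁ α₂ : ℝ} (h₀ : 0 ≤ α₀) (h₁ : 0 ≤ α₁)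
    (h : (α₀ ≤ α₂ ∧ Integrable (fun y : Vd n => (1 + ‖y‖ ^ 2) ^ (-(α₁ + α₂ - α₀)))) ∨
      (1 ≤ n ∧ α₁ < (n : ℝ) / 2 ∧ (n : ℝ) / 2 < α₁ + α₂ ∧ α₀ = α₁ + α₂ - (n : ℝ) / 2)) :
    ∃ K : ℝ≥0, ∀ A B : ℝ, 1 ≤ A → A ≤ B →
      ∫⁻ y : Vd n, ENNReal.ofReal ((A + ‖y‖ ^ 2) ^ (-α₁) * (B + ‖y‖ ^ 2) ^ (-α₂)) ≤
        K * ENNReal.ofReal (B ^ (-α₀)) := by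
  obtain ⟨h₀₂, hi⟩ | ⟨hn, h1, hs, he⟩ := h
  · refine ⟨(∫⁻ y : Vd n, ENNReal.ofReal ((1 + ‖y‖ ^ 2) ^ (-(α₁ + α₂ - α₀)))).toNNReal,
      fun A B hA hAB => ?_⟩
    rw [ENNReal.coe_toNNReal hi.lintegral_lt_top.ne, mul_comm,
      ← lintegral_const_mul' _ _ ENNReal.ofReal_ne_top]
    refine lintegral_mono fun y => ?_
    have hB : 0 ≤ B := by linarith
    rw [← ENNReal.ofReal_mul (by positivity)]
    exact ENNReal.ofReal_le_ofReal (weight_le_of_le hA hAB (by positivity) h₀ h₁ h₀₂)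
  · have : Nonempty (Fin n) := ⟨⟨0, hn⟩⟩
    have hi := integrable_norm_rpow_mul_one_add_norm_sq_rpow hn h1 hs
    set f : Vd n → ℝ := fun z => ‖z‖ ^ (-(2 * α₁)) * (1 + ‖z‖ ^ 2) ^ (-α₂) with hf
    refine ⟨(∫⁻ z, ENNReal.ofReal (f z)).toNNReal, fun A B hA hAB => ?_⟩
    have hB : 0 < B := by linarith
    have hc : 0 < B ^ (-(1 / 2) : ℝ) := by positivity
    have hscale : ∫⁻ y : Vd n, ENNReal.ofReal (f (B ^ (-(1 / 2) : ℝ) • y)) =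
        ENNReal.ofReal (B ^ ((n : ℝ) / 2)) * ∫⁻ z, ENNReal.ofReal (f z) := by
      have hm : Measurable fun z : Vd n => ENNReal.ofReal (f z) := by fun_prop
      rw [← lintegral_map (f := fun z => ENNReal.ofReal (f z)) hm (measurable_const_smul _),
        Measure.map_addHaar_smul volume hc.ne', lintegral_smul_measure, smul_eq_mul,
        finrank_euclideanSpace_fin]
      congr 2
      rw [abs_of_pos (by positivity), ← Real.rpow_natCast, ← Real.rpow_mul hB.le,
        ← Real.rpow_neg hB.le]
      congr 1; ring
    calc ∫⁻ y : Vd n, ENNReal.ofReal ((A + ‖y‖ ^ 2) ^ (-α₁) * (B + ‖y‖ ^ 2) ^ (-α₂))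
        ≤ ∫⁻ y : Vd n, ENNReal.ofReal (B ^ (-(α₁ + α₂))) *
            ENNReal.ofReal (f (B ^ (-(1 / 2) : ℝ) • y)) := by
          refine lintegral_mono_ae ?_
          filter_upwards [compl_mem_ae_iff.mpr (measure_singleton (0 : Vd n))] with y hy
          rw [← ENNReal.ofReal_mul (by positivity)]
          exact ENNReal.ofReal_le_ofReal (weight_le_scaled hA hAB h₁ hy)
      _ = _ := by
          rw [lintegral_const_mul' _ _ ENNReal.ofReal_ne_top, hscale,
            ENNReal.coe_toNNReal hi.lintegral_lt_top.ne, ← mul_assoc,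
            ← ENNReal.ofReal_mul (by positivity), ← Real.rpow_add hB, mul_comm, he]
          congr 3; ring

/-- The weight integrated over a hyperplane orthogonal to `ξ`, uniformly in the hyperplane. -/
theorem lintegral_weight_le {n : ℕ} {α₀ α₁ α₂ : ℝ} (h₀ : 0 ≤ α₀) (h₁ : 0 ≤ α₁) (h₂ : 0 ≤ α₂)
    (h : (α₀ ≤ min α₁ α₂ ∧ Integrable (fun y : Vd n => (1 + ‖y‖ ^ 2) ^ (-(α₁ + α₂ - α₀)))) ∨
      (1 ≤ n ∧ max α₁ α₂ < (n : ℝ) / 2 ∧ (n : ℝ) / 2 < α₁ + α₂ ∧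
        α₀ = α₁ + α₂ - (n : ℝ) / 2)) :
    ∃ K : ℝ≥0, ∀ A B : ℝ, 1 ≤ A → 1 ≤ B →
      ∫⁻ y : Vd n, ENNReal.ofReal ((A + ‖y‖ ^ 2) ^ (-α₁) * (B + ‖y‖ ^ 2) ^ (-α₂)) ≤
        K * ENNReal.ofReal ((max A B) ^ (-α₀)) := by
  obtain ⟨K₁, hK₁⟩ := lintegral_weight_le_of_le (n := n) h₀ h₁ (by
    refine h.imp (fun h => ⟨h.1.trans (min_le_right _ _), h.2⟩) fun h => ?_
    exact ⟨h.1, (le_max_left _ _).trans_lt h.2.1, h.2.2.1, h.2.2.2⟩)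
  obtain ⟨K₂, hK₂⟩ := lintegral_weight_le_of_le (n := n) h₀ h₂ (by
    refine h.imp (fun h => ⟨h.1.trans (min_le_left _ _), ?_⟩) fun h => ?_
    · rw [add_comm α₂]; exact h.2
    · rw [add_comm α₂]; exact ⟨h.1, (le_max_right _ _).trans_lt h.2.1, h.2.2.1, h.2.2.2⟩)
  refine ⟨max K₁ K₂, fun A B hA hB => ?_⟩
  obtain hAB | hAB := le_total A B
  · rw [max_eq_right hAB]
    refine (hK₁ A B hA hAB).trans ?_
    gcongr
    exact le_max_left _ _
  · rw [max_eq_left hAB]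
    simp_rw [mul_comm ((A + _) ^ (-α₁))]
    refine (hK₂ B A hB hAB).trans ?_
    gcongr
    exact le_max_right _ _

theorem jb_rpow {d : ℕ} (ξ : Vd d) (α : ℝ) : jb ξ ^ (2 * α) = (1 + ‖ξ‖ ^ 2) ^ α := by
  rw [jb, ← Real.rpow_mul (by positivity)]
  ring_nf

theorem jb_pos {d : ℕ} (ξ : Vd d) : 0 < jb ξ := by
  unfold jb; positivity

theorem measurable_jb {d : ℕ} : Measurable (jb : Vd d → ℝ) := by
  unfold jb; fun_prop

/-- Cauchy–Schwarz against a positive weight. -/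
theorem enorm_integral_sq_le_of_weight {α : Type*} [MeasurableSpace α] {μ : Measure α}
    {g : α → ℂ} {w : α → ℝ} (hg : AEStronglyMeasurable g μ) (hw : Measurable w)
    (hpos : ∀ y, 0 < w y) :
    ‖∫ y, g y ∂μ‖ₑ ^ (2 : ℝ) ≤
      (∫⁻ y, ENNReal.ofReal (w y)⁻¹ ∂μ) * ∫⁻ y, ENNReal.ofReal (w y) * ‖g y‖ₑ ^ (2 : ℝ) ∂μ := by
  have hh := ENNReal.lintegral_mul_le_Lp_mul_Lq μ Real.HolderConjugate.two_two
    (f := fun y => ENNReal.ofReal ((w y)⁻¹ ^ (1 / 2 : ℝ)))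
    (g := fun y => ENNReal.ofReal (w y ^ (1 / 2 : ℝ)) * ‖g y‖ₑ)
    (by fun_prop) ((by fun_prop : AEMeasurable _ μ).mul hg.enorm)
  have hcancel : ∀ y, ENNReal.ofReal ((w y)⁻¹ ^ (1 / 2 : ℝ)) *
      (ENNReal.ofReal (w y ^ (1 / 2 : ℝ)) * ‖g y‖ₑ) = ‖g y‖ₑ := by
    intro y
    have := hpos y
    rw [← mul_assoc, ← ENNReal.ofReal_mul (by positivity),
      ← Real.mul_rpow (by positivity) (by positivity), inv_mul_cancel₀ this.ne']
    simp
  have hsq : ∀ x : ℝ, 0 ≤ x → ENNReal.ofReal (x ^ (1 / 2 : ℝ)) ^ (2 : ℝ) = ENNReal.ofReal x := by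
    intro x hx
    rw [ENNReal.ofReal_rpow_of_nonneg (by positivity) (by norm_num), ← Real.rpow_mul hx]
    norm_num
  simp only [Pi.mul_apply, hcancel] at hh
  simp_rw [ENNReal.mul_rpow_of_nonneg _ _ (zero_le_two (α := ℝ)), hsq _ (hpos _).le,
    hsq _ (inv_pos.mpr (hpos _)).le] at hh
  calc ‖∫ y, g y ∂μ‖ₑ ^ (2 : ℝ) ≤ (∫⁻ y, ‖g y‖ₑ ∂μ) ^ (2 : ℝ) := by
        gcongr
        exact enorm_integral_le_lintegral_enorm _
    _ ≤ _ := ENNReal.rpow_le_rpow hh zero_le_two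
    _ = _ := by
        rw [ENNReal.mul_rpow_of_nonneg _ _ zero_le_two, ← ENNReal.rpow_mul, ← ENNReal.rpow_mul]
        norm_num

theorem lintegral_comp_mul_left_real {f : ℝ → ℝ≥0∞} (hf : Measurable f) {c : ℝ} (hc : 0 < c) :
    ∫⁻ t, f (c * t) = ENNReal.ofReal c⁻¹ * ∫⁻ t, f t := by
  rw [← lintegral_map hf (measurable_const_mul c), Real.map_volume_mul_left hc.ne',
    lintegral_smul_measure, abs_of_pos (by positivity), smul_eq_mul]

open FourierTransform in
/-- The space-time estimate at a fixed nonzero frequency `ξ`. -/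
theorem lintegral_enorm_oscillatory_sq_le {n : ℕ} {α₀ α₁ α₂ : ℝ} (h₀ : 0 ≤ α₀) {K : ℝ≥0}
    (hK : ∀ A B : ℝ, 1 ≤ A → 1 ≤ B →
      ∫⁻ y : Vd n, ENNReal.ofReal ((A + ‖y‖ ^ 2) ^ (-α₁) * (B + ‖y‖ ^ 2) ^ (-α₂)) ≤
        K * ENNReal.ofReal ((max A B) ^ (-α₀)))
    {ξ : Vd (n + 1)} (hξ : ξ ≠ 0) {g : Vd (n + 1) → ℂ} (hg : StronglyMeasurable g) :
    ENNReal.ofReal (‖ξ‖ * jb ξ ^ (2 * α₀)) * ∫⁻ t : ℝ,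
      ‖∫ η, Complex.exp (-(Complex.I * Complex.ofReal (t * (‖η‖ ^ 2 - ‖ξ - η‖ ^ 2)))) * g η‖ₑ
        ^ (2 : ℝ) ≤
      ENNReal.ofReal (Real.pi * 4 ^ α₀) * K * ∫⁻ η,
        ENNReal.ofReal (jb η ^ (2 * α₁) * jb (ξ - η) ^ (2 * α₂)) * ‖g η‖ₑ ^ (2 : ℝ) := by
  have hn : 0 < ‖ξ‖ := norm_pos_iff.mpr hξ
  by_cases hint : Integrable g
  swap
  · have hzero : ∀ t : ℝ, ∫ η, Complex.exp
        (-(Complex.I * Complex.ofReal (t * (‖η‖ ^ 2 - ‖ξ - η‖ ^ 2)))) * g η = 0 := by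
      intro t
      refine integral_undef fun hc => hint ?_
      refine (integrable_norm_iff hg.aestronglyMeasurable).mp (hc.norm.congr ?_)
      refine .of_forall fun η => ?_
      have hphase : -(Complex.I * Complex.ofReal (t * (‖η‖ ^ 2 - ‖ξ - η‖ ^ 2))) =
          Complex.ofReal (-(t * (‖η‖ ^ 2 - ‖ξ - η‖ ^ 2))) * Complex.I := by
        push_cast; ring
      simp only [hphase]
      rw [norm_mul, Complex.norm_exp_ofReal_mul_I, one_mul]
    simp_rw [hzero]
    simp
  obtain ⟨e, he, hexy⟩ := exists_orthogonal_coordinates hξ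
  have hsub : ∀ s y, ‖ξ - e (s, y)‖ ^ 2 = (‖ξ‖ - s) ^ 2 + ‖y‖ ^ 2 := by
    intro s y
    rw [@norm_sub_sq_real, real_inner_comm, (hexy s y).1, (hexy s y).2]
    ring
  set gp : ℝ × Vd n → ℂ := fun p => g (e p) with hgp
  have hgpm : StronglyMeasurable gp := hg.comp_measurable e.measurable
  have hgpi : Integrable gp := (he.integrable_comp_emb e.measurableEmbedding).mpr hint
  set h : ℝ → ℂ := fun s => ∫ y, gp (s, y) with hh
  have hhi : Integrable h := hgpi.integral_prod_left
  have hfourier : ∀ t : ℝ, ‖∫ η, Complex.exp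
      (-(Complex.I * Complex.ofReal (t * (‖η‖ ^ 2 - ‖ξ - η‖ ^ 2)))) * g η‖ₑ =
        ‖𝓕 h (‖ξ‖ / Real.pi * t)‖ₑ := by
    intro t
    have hexp : ∀ p : ℝ × Vd n, Complex.exp
        (-(Complex.I * Complex.ofReal (t * (‖e p‖ ^ 2 - ‖ξ - e p‖ ^ 2)))) * g (e p) =
        Complex.exp ((t * ‖ξ‖ ^ 2 : ℝ) * Complex.I) *
          (Complex.exp ((-2 * Real.pi * p.1 * (‖ξ‖ / Real.pi * t) : ℝ) * Complex.I) * gp p) := by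
      rintro ⟨s, y⟩
      rw [(hexy s y).2, hsub, ← mul_assoc, ← Complex.exp_add]
      congr 2
      have : -2 * Real.pi * s * (‖ξ‖ / Real.pi * t) = -2 * s * ‖ξ‖ * t := by
        field_simp
      rw [this]
      push_cast
      ring
    have hosc : Integrable fun p : ℝ × Vd n =>
        Complex.exp ((-2 * Real.pi * p.1 * (‖ξ‖ / Real.pi * t) : ℝ) * Complex.I) * gp p := by
      refine hgpi.norm.mono' ?_ (.of_forall fun p => ?_)
      · exact (by fun_prop : Continuous fun p : ℝ × Vd n => Complex.exp
          ((-2 * Real.pi * p.1 * (‖ξ‖ / Real.pi * t) : ℝ) * Complex.I)).aestronglyMeasurable.mul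
          hgpm.aestronglyMeasurable
      · rw [norm_mul, Complex.norm_exp_ofReal_mul_I, one_mul]
    rw [← he.integral_comp', integral_congr_ae (.of_forall hexp), integral_const_mul, enorm_mul,
      ← ofReal_norm (Complex.exp _), Complex.norm_exp_ofReal_mul_I, ENNReal.ofReal_one, one_mul,
      Measure.volume_eq_prod, integral_prod _ hosc, Real.fourier_real_eq_integral_exp_smul]
    simp only [integral_const_mul, smul_eq_mul, hh]
  have hcont : Continuous (𝓕 h) :=
    VectorFourier.fourierIntegral_continuous Real.continuous_fourierChar
      (innerSL ℝ).continuous₂ hhi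
  have hplanch : ∫⁻ t : ℝ, ‖𝓕 h (‖ξ‖ / Real.pi * t)‖ₑ ^ (2 : ℝ) ≤
      ENNReal.ofReal (‖ξ‖ / Real.pi)⁻¹ * ∫⁻ s, ‖h s‖ₑ ^ (2 : ℝ) := by
    rw [lintegral_comp_mul_left_real (f := fun t => ‖𝓕 h t‖ₑ ^ (2 : ℝ))
      (hcont.measurable.enorm.pow_const _) (by positivity)]
    exact mul_le_mul_right (lintegral_enorm_fourier_sq_le hhi) _
  set w : Vd (n + 1) → ℝ := fun η => jb η ^ (2 * α₁) * jb (ξ - η) ^ (2 * α₂) with hw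
  have hwm : Measurable w := by
    have := measurable_jb (d := n + 1)
    fun_prop
  have hwpos : ∀ η, 0 < w η := fun η => by
    have := jb_pos η
    have := jb_pos (ξ - η)
    positivity
  have hslice : ∀ s, ‖h s‖ₑ ^ (2 : ℝ) ≤ K * ENNReal.ofReal (4 ^ α₀ * (jb ξ ^ (2 * α₀))⁻¹) *
      ∫⁻ y, ENNReal.ofReal (w (e (s, y))) * ‖gp (s, y)‖ₑ ^ (2 : ℝ) := by
    intro s
    have hle := enorm_integral_sq_le_of_weight (μ := (volume : Measure (Vd n)))
      (g := fun y => gp (s, y)) (w := fun y => w (e (s, y)))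
      (hgpm.comp_measurable measurable_prodMk_left).aestronglyMeasurable
      (hwm.comp (e.measurable.comp measurable_prodMk_left)) (fun y => hwpos _)
    refine hle.trans (mul_le_mul_left ?_ _)
    have hwe : ∀ y, (w (e (s, y)))⁻¹ = (1 + s ^ 2 + ‖y‖ ^ 2) ^ (-α₁) *
        (1 + (‖ξ‖ - s) ^ 2 + ‖y‖ ^ 2) ^ (-α₂) := by
      intro y
      simp only [hw]
      rw [jb_rpow, jb_rpow, (hexy s y).2, hsub, mul_inv, ← Real.rpow_neg (by positivity),
        ← Real.rpow_neg (by positivity), add_assoc, add_assoc]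
    simp_rw [hwe]
    refine (hK _ _ (by nlinarith) (by nlinarith)).trans ?_
    gcongr
    have hmax : (1 + ‖ξ‖ ^ 2) / 4 ≤ max (1 + s ^ 2) (1 + (‖ξ‖ - s) ^ 2) := by
      have := le_max_left (1 + s ^ 2) (1 + (‖ξ‖ - s) ^ 2)
      have := le_max_right (1 + s ^ 2) (1 + (‖ξ‖ - s) ^ 2)
      nlinarith [sq_nonneg (‖ξ‖ - 2 * s)]
    calc (max (1 + s ^ 2) (1 + (‖ξ‖ - s) ^ 2)) ^ (-α₀) ≤ ((1 + ‖ξ‖ ^ 2) / 4) ^ (-α₀) :=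
          Real.rpow_le_rpow_of_nonpos (by positivity) hmax (by linarith)
      _ = 4 ^ α₀ * (jb ξ ^ (2 * α₀))⁻¹ := by
          rw [jb_rpow, Real.div_rpow (by positivity) (by norm_num), Real.rpow_neg (by positivity),
            Real.rpow_neg (by norm_num)]
          field_simp
  have hbody : Measurable fun η => ENNReal.ofReal (w η) * ‖g η‖ₑ ^ (2 : ℝ) :=
    hwm.ennreal_ofReal.mul (hg.enorm.pow_const _)
  have htotal : ∫⁻ s, ‖h s‖ₑ ^ (2 : ℝ) ≤
      K * ENNReal.ofReal (4 ^ α₀ * (jb ξ ^ (2 * α₀))⁻¹) *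
        ∫⁻ η, ENNReal.ofReal (w η) * ‖g η‖ₑ ^ (2 : ℝ) := by
    rw [← he.lintegral_comp hbody, Measure.volume_eq_prod,
      lintegral_prod (fun p : ℝ × Vd n => ENNReal.ofReal (w (e p)) * ‖g (e p)‖ₑ ^ (2 : ℝ))
        (hbody.comp e.measurable).aemeasurable,
      ← lintegral_const_mul' _ _ (by finiteness)]
    exact lintegral_mono hslice
  simp_rw [hfourier]
  have hj : 0 < jb ξ ^ (2 * α₀) := Real.rpow_pos_of_pos (jb_pos ξ) _
  calc _ ≤ ENNReal.ofReal (‖ξ‖ * jb ξ ^ (2 * α₀)) * (ENNReal.ofReal (‖ξ‖ / Real.pi)⁻¹ *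
        (K * ENNReal.ofReal (4 ^ α₀ * (jb ξ ^ (2 * α₀))⁻¹) *
          ∫⁻ η, ENNReal.ofReal (w η) * ‖g η‖ₑ ^ (2 : ℝ))) := by
        gcongr
        exact hplanch.trans (by gcongr)
    _ = (ENNReal.ofReal (‖ξ‖ * jb ξ ^ (2 * α₀)) * ENNReal.ofReal (‖ξ‖ / Real.pi)⁻¹ *
        ENNReal.ofReal (4 ^ α₀ * (jb ξ ^ (2 * α₀))⁻¹)) * K *
          ∫⁻ η, ENNReal.ofReal (w η) * ‖g η‖ₑ ^ (2 : ℝ) := by ring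
    _ = _ := by
        rw [← ENNReal.ofReal_mul (by positivity), ← ENNReal.ofReal_mul (by positivity)]
        congr 3
        field_simp

/-- The squared estimate for strongly measurable `G`. -/
theorem lintegral_lintegral_densFT_sq_le {n : ℕ} {α₀ α₁ α₂ : ℝ} (h₀ : 0 ≤ α₀) {K : ℝ≥0}
    (hK : ∀ A B : ℝ, 1 ≤ A → 1 ≤ B →
      ∫⁻ y : Vd n, ENNReal.ofReal ((A + ‖y‖ ^ 2) ^ (-α₁) * (B + ‖y‖ ^ 2) ^ (-α₂)) ≤
        K * ENNReal.ofReal ((max A B) ^ (-α₀)))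
    {G : Vd (n + 1) × Vd (n + 1) → ℂ} (hG : StronglyMeasurable G) :
    ∫⁻ t : ℝ, ∫⁻ ξ : Vd (n + 1),
      ENNReal.ofReal (‖ξ‖ ^ (2 * ((1 : ℝ) / 2)) * jb ξ ^ (2 * α₀)) * ‖densFT G t ξ‖ₑ ^ (2 : ℝ) ≤
    ‖((2 * Real.pi) ^ (n + 1))⁻¹‖ₑ ^ (2 : ℝ) * (ENNReal.ofReal (Real.pi * 4 ^ α₀) * K) *
      ∫⁻ p : Vd (n + 1) × Vd (n + 1),
        ENNReal.ofReal (jb p.1 ^ (2 * α₁) * jb p.2 ^ (2 * α₂)) * ‖G p‖ₑ ^ (2 : ℝ) := by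
  have hjb := measurable_jb (d := n + 1)
  have hdens : StronglyMeasurable fun p : ℝ × Vd (n + 1) => densFT G p.1 p.2 := by
    suffices hI : StronglyMeasurable fun p : ℝ × Vd (n + 1) => ∫ η : Vd (n + 1),
      Complex.exp (-(Complex.I * Complex.ofReal (p.1 * (‖η‖ ^ 2 - ‖p.2 - η‖ ^ 2)))) *
        G (η, p.2 - η) from hI.const_smul (((2 * Real.pi) ^ (n + 1))⁻¹ : ℝ)
    refine StronglyMeasurable.integral_prod_right' (ν := (volume : Measure (Vd (n + 1))))
      (f := fun q : (ℝ × Vd (n + 1)) × Vd (n + 1) => Complex.exp (-(Complex.I *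
        Complex.ofReal (q.1.1 * (‖q.2‖ ^ 2 - ‖q.1.2 - q.2‖ ^ 2)))) * G (q.2, q.1.2 - q.2)) ?_
    refine StronglyMeasurable.mul (Continuous.stronglyMeasurable (by fun_prop)) ?_
    exact hG.comp_measurable (by fun_prop)
  have hprod : Measurable fun p : Vd (n + 1) × Vd (n + 1) =>
      ENNReal.ofReal (jb p.1 ^ (2 * α₁) * jb p.2 ^ (2 * α₂)) * ‖G p‖ₑ ^ (2 : ℝ) := by
    refine Measurable.mul (by fun_prop) (hG.enorm.pow_const _)
  rw [lintegral_lintegral_swap]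
  swap
  · refine Measurable.aemeasurable (Measurable.mul (by fun_prop) (hdens.enorm.pow_const _))
  have hchange : ∫⁻ p : Vd (n + 1) × Vd (n + 1),
        ENNReal.ofReal (jb p.1 ^ (2 * α₁) * jb p.2 ^ (2 * α₂)) * ‖G p‖ₑ ^ (2 : ℝ) =
      ∫⁻ ξ : Vd (n + 1), ∫⁻ η : Vd (n + 1),
        ENNReal.ofReal (jb η ^ (2 * α₁) * jb (ξ - η) ^ (2 * α₂)) * ‖G (η, ξ - η)‖ₑ ^ (2 : ℝ) := by
    rw [Measure.volume_eq_prod,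
      ← (measurePreserving_prod_sub_swap (volume : Measure (Vd (n + 1)))
        (volume : Measure (Vd (n + 1)))).lintegral_comp hprod]
    exact lintegral_prod _ (hprod.comp (by fun_prop)).aemeasurable
  rw [hchange, ← lintegral_const_mul' _ _ (by finiteness)]
  refine lintegral_mono_ae ?_
  filter_upwards [compl_mem_ae_iff.mpr (measure_singleton (0 : Vd (n + 1)))] with ξ hξ
  have hmain := lintegral_enorm_oscillatory_sq_le h₀ hK hξ
    (g := fun η => G (η, ξ - η)) (hG.comp_measurable (by fun_prop))
  rw [lintegral_const_mul' _ _ ENNReal.ofReal_ne_top]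
  simp_rw [densFT, enorm_smul, ENNReal.mul_rpow_of_nonneg _ _ (zero_le_two (α := ℝ))]
  rw [lintegral_const_mul' _ _ (by finiteness), mul_one_div_cancel two_ne_zero, Real.rpow_one,
    mul_left_comm, mul_assoc]
  gcongr

theorem densStriNorm_le {n : ℕ} {α₀ α₁ α₂ : ℝ} (h₀ : 0 ≤ α₀) {K : ℝ≥0}
    (hK : ∀ A B : ℝ, 1 ≤ A → 1 ≤ B →
      ∫⁻ y : Vd n, ENNReal.ofReal ((A + ‖y‖ ^ 2) ^ (-α₁) * (B + ‖y‖ ^ 2) ^ (-α₂)) ≤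
        K * ENNReal.ofReal ((max A B) ^ (-α₀))) :
    ∃ C : ℝ≥0, ∀ G : Vd (n + 1) × Vd (n + 1) → ℂ, AEStronglyMeasurable G volume →
      densStriNorm ((1 : ℝ) / 2) α₀ G ≤ C * wHSnorm α₁ α₂ G := by
  set M : ℝ≥0∞ := ‖((2 * Real.pi) ^ (n + 1))⁻¹‖ₑ ^ (2 : ℝ) *
    (ENNReal.ofReal (Real.pi * 4 ^ α₀) * K) with hM
  have hMtop : M ≠ ⊤ := by finiteness
  refine ⟨(M ^ ((1 : ℝ) / 2)).toNNReal, fun G hG => ?_⟩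
  rw [ENNReal.coe_toNNReal (by finiteness)]
  obtain ⟨G', hG', hGG'⟩ := hG
  have hdens : ∀ t, ∀ᵐ ξ, densFT G t ξ = densFT G' t ξ := by
    intro t
    have hae : ∀ᵐ p : Vd (n + 1) × Vd (n + 1), G (p.2, p.1 - p.2) = G' (p.2, p.1 - p.2) :=
      (measurePreserving_prod_sub_swap (volume : Measure (Vd (n + 1)))
        (volume : Measure (Vd (n + 1)))).quasiMeasurePreserving.ae hGG'
    filter_upwards [Measure.ae_ae_of_ae_prod hae] with ξ hξ
    unfold densFT
    congr 1
    refine integral_congr_ae ?_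
    filter_upwards [hξ] with η hη
    rw [hη]
  have hl : densStriNorm ((1 : ℝ) / 2) α₀ G = densStriNorm ((1 : ℝ) / 2) α₀ G' := by
    unfold densStriNorm
    congr 1
    refine lintegral_congr fun t => lintegral_congr_ae ?_
    filter_upwards [hdens t] with ξ hξ
    rw [hξ]
  have hr : wHSnorm α₁ α₂ G = wHSnorm α₁ α₂ G' := by
    unfold wHSnorm
    congr 1
    refine lintegral_congr_ae ?_
    filter_upwards [hGG'] with p hp
    rw [hp]
  rw [hl, hr, densStriNorm, wHSnorm, ← ENNReal.mul_rpow_of_nonneg _ _ (by norm_num)]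
  exact ENNReal.rpow_le_rpow (lintegral_lintegral_densFT_sq_le h₀ hK hG') (by norm_num)

/-- Strichartz estimates for density functions, Theorem 3.1.
For `d = 1` assume `α₀ = min{α₁,α₂}`; for `d ≥ 2` assume `α₁+α₂ > (d-1)/2` together with the
three-case condition on `α₀`.  Then
`‖ |∇|^{1/2} ρ_{e^{itΔ}γ₀e^{-itΔ}} ‖_{L²_t H^{α₀}_x} ≤ C ‖⟨∇⟩^{α₁} γ₀ ⟨∇⟩^{α₂}‖_{𝔖²}`
for every Hilbert–Schmidt `γ₀` (described through `G = γ̂₀`, the Fourier transform of its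
integral kernel; both sides are computed on the Fourier side via Plancherel). -/
theorem strichartz_estimates_for_density_functions
    (d : ℕ) (hd : 1 ≤ d) (α₀ α₁ α₂ : ℝ) (h₀ : 0 ≤ α₀) (h₁ : 0 ≤ α₁) (h₂ : 0 ≤ α₂)
    (hd1 : d = 1 → α₀ = min α₁ α₂)
    (hd2 : 2 ≤ d → (((d:ℝ) - 1) / 2 < α₁ + α₂ ∧
      (max α₁ α₂ < ((d:ℝ) - 1) / 2 → α₀ = α₁ + α₂ - ((d:ℝ) - 1) / 2) ∧
      (max α₁ α₂ = ((d:ℝ) - 1) / 2 → α₀ < min α₁ α₂) ∧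
      (((d:ℝ) - 1) / 2 < max α₁ α₂ → α₀ = min α₁ α₂))) :
    ∃ C : ℝ≥0, 0 < C ∧ ∀ G : Vd d × Vd d → ℂ, AEStronglyMeasurable G volume →
      densStriNorm ((1:ℝ)/2) α₀ G ≤ C * wHSnorm α₁ α₂ G := by
  obtain ⟨n, rfl⟩ : ∃ n, d = n + 1 := ⟨d - 1, by omega⟩
  have hcast : (((n + 1 : ℕ) : ℝ) - 1) / 2 = (n : ℝ) / 2 := by push_cast; ring
  rw [hcast] at hd2
  have hweight : ∃ K : ℝ≥0, ∀ A B : ℝ, 1 ≤ A → 1 ≤ B →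
      ∫⁻ y : Vd n, ENNReal.ofReal ((A + ‖y‖ ^ 2) ^ (-α₁) * (B + ‖y‖ ^ 2) ^ (-α₂)) ≤
        K * ENNReal.ofReal ((max A B) ^ (-α₀)) := by
    refine lintegral_weight_le h₀ h₁ h₂ ?_
    obtain rfl | hn := Nat.eq_zero_or_pos n
    · exact .inl ⟨(hd1 rfl).le, .of_finite⟩
    obtain ⟨hs, hlt, heq, hgt⟩ := hd2 (by omega)
    have hint : (n : ℝ) / 2 < α₁ + α₂ - α₀ →
        Integrable (fun y : Vd n => (1 + ‖y‖ ^ 2) ^ (-(α₁ + α₂ - α₀))) := by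
      intro h
      have := integrable_rpow_neg_one_add_norm_sq (E := Vd n) (μ := volume)
        (r := 2 * (α₁ + α₂ - α₀)) (by rw [finrank_euclideanSpace_fin]; linarith)
      convert! this using 3
      ring
    have hmm := min_add_max α₁ α₂
    obtain h | h | h := lt_trichotomy (max α₁ α₂) ((n : ℝ) / 2)
    · exact .inr ⟨hn, h, hs, hlt h⟩
    · have := heq h
      exact .inl ⟨this.le, hint (by linarith)⟩
    · have := hgt h
      exact .inl ⟨this.le, hint (by linarith)⟩
  obtain ⟨K, hK⟩ := hweight
  obtain ⟨C, hC⟩ := densStriNorm_le h₀ hK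
  refine ⟨C + 1, by positivity, fun G hG => (hC G hG).trans ?_⟩
  gcongr
  exact le_self_add
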